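/- arXiv:1803.09988 — 9 statements merged into one kernel-verified Lean document; each statement's English description precedes it below -/
import Mathlib

section
/- Let q be a prime power and let C be a linear code over GF(q). If w_min/w_max > (q-1)/q, where w_min and w_max denote the minimum and maximum nonzero Hamming weights among codewords of C, then C is a minimal linear code. -/
/-- If `u` covers `v`, the weights of the vectors `v - a • u`, over all scalars `a`,
add up to `(q - 1)` times the weight of `u`. -/
theorem sum_hammingNorm_sub_smul {ι F : Type*} [Fintype ι] [Field F] [Fintype F] [DecidableEq F]
    {u v : ι → F} (huv : ∀ i, v i ≠ 0 → u i ≠ 0) :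
    ∑ a : F, hammingNorm (v - a • u) = (Fintype.card F - 1) * hammingNorm u := by
  have key (i : ι) : (∑ a : F, if (v - a • u) i ≠ 0 then 1 else 0) =
      if u i ≠ 0 then Fintype.card F - 1 else 0 := by
    by_cases hu : u i = 0
    · have hv : v i = 0 := by
        by_contra hv
        exact huv i hv hu
      simp [hu, hv]
    · have hs : (Finset.univ.filter fun a : F => (v - a • u) i ≠ 0) =
          Finset.univ.erase (v i / u i) := by
        ext a
        simp [sub_eq_zero, eq_div_iff hu, eq_comm]
      rw [← Finset.card_filter, hs, Finset.card_erase_of_mem (Finset.mem_univ _),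
        Finset.card_univ, if_pos hu]
  simp only [hammingNorm, Finset.card_filter]
  rw [Finset.sum_comm, Finset.sum_congr rfl fun i _ => key i, Finset.mul_sum]
  simp

/-- Ashikhmin–Barg: a linear code `C ⊆ GF(q)^n` with
`w_min / w_max > (q-1)/q` is minimal, i.e. every codeword covers only
its scalar multiples. -/
theorem stmt_0 {n : ℕ} {F : Type*} [Field F] [Fintype F] [DecidableEq F]
    (hq : IsPrimePow (Fintype.card F))
    (C : Submodule F (Fin n → F)) (hC : ∃ v ∈ C, v ≠ 0)
    (wmin wmax : ℕ)
    (hmin : wmin = sInf {w : ℕ | ∃ v ∈ C, v ≠ 0 ∧ hammingNorm v = w})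
    (hmax : wmax = sSup {w : ℕ | ∃ v ∈ C, v ≠ 0 ∧ hammingNorm v = w})
    (h : ((Fintype.card F : ℚ) - 1) / (Fintype.card F : ℚ) < (wmin : ℚ) / (wmax : ℚ)) :
    ∀ u ∈ C, ∀ v ∈ C, (∀ i, v i ≠ 0 → u i ≠ 0) → ∃ a : F, v = a • u := by
  intro u hu v hv huv
  by_contra! hne
  have hu0 : u ≠ 0 := by
    rintro rfl
    refine hne 0 (funext fun i => ?_)
    by_contra hi
    exact huv i (by simpa using hi) rfl
  have hle_max : hammingNorm u ≤ wmax := by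
    rw [hmax]
    refine le_csSup ⟨n, ?_⟩ ⟨u, hu, hu0, rfl⟩
    rintro w ⟨x, -, -, rfl⟩
    simpa using hammingNorm_le_card_fintype (x := x)
  have hmin_le (a : F) : wmin ≤ hammingNorm (v - a • u) := by
    rw [hmin]
    exact Nat.sInf_le ⟨_, C.sub_mem hv (C.smul_mem a hu), sub_ne_zero.mpr (hne a), rfl⟩
  have hsum : Fintype.card F * wmin ≤ (Fintype.card F - 1) * wmax := by
    calc Fintype.card F * wmin = ∑ _a : F, wmin := by simp
      _ ≤ ∑ a : F, hammingNorm (v - a • u) := Finset.sum_le_sum fun a _ => hmin_le a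
      _ = (Fintype.card F - 1) * hammingNorm u := sum_hammingNorm_sub_smul huv
      _ ≤ _ := Nat.mul_le_mul_left _ hle_max
  have hcard : 0 < Fintype.card F := Fintype.card_pos
  have hwmax : 0 < wmax := (hammingNorm_pos_iff.mpr hu0).trans_le hle_max
  rw [div_lt_div_iff₀ (by exact_mod_cast hcard) (by exact_mod_cast hwmax)] at h
  have hsum' : (Fintype.card F : ℚ) * wmin ≤ ((Fintype.card F : ℚ) - 1) * wmax := by
    have := (Nat.cast_le (α := ℚ)).mpr hsum
    rwa [Nat.cast_mul, Nat.cast_mul, Nat.cast_pred hcard] at this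
  linarith
end

section
/- Let q be a prime power, m and t integers with 0 <= t <= m, and let u be a vector in (Z/qZ)^m of Hamming weight i. Then the sum of zeta_q^(u . v), taken over all vectors v in (Z/qZ)^m of Hamming weight exactly t, equals K_t(i,m), where zeta_q = exp(2*pi*I/q) is a primitive q-th complex root of unity and u . v = u_1*v_1 + ... + u_m*v_m is the standard inner product in (Z/qZ)^m (with the exponent of zeta_q taken as the integer representative). -/
/-- The Krawtchouk polynomial `K_t(x,m)` with parameter `q`. -/
def krawtchouk (q t x m : ℕ) : ℤ :=
  ∑ j ∈ Finset.range (t + 1),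
    (-1 : ℤ) ^ j * ((q : ℤ) - 1) ^ (t - j) * (x.choose j) * ((m - x).choose (t - j))

/-- An additive character maps finite sums to products. -/
theorem AddChar.map_sum_eq_prod {A M ι : Type*} [AddCommMonoid A] [CommMonoid M]
    (ψ : AddChar A M) (s : Finset ι) (f : ι → A) : ψ (∑ i ∈ s, f i) = ∏ i ∈ s, ψ (f i) :=
  map_prod ψ.toMonoidHom (fun i => Multiplicative.ofAdd (f i)) s

open Polynomial in
theorem sum_stdAddChar_mul_weight {q : ℕ} [NeZero q] (b : ZMod q) :
    ∑ a : ZMod q, C (ZMod.stdAddChar (b * a)) * (if a ≠ 0 then X else 1 : ℂ[X]) =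
      if b ≠ 0 then 1 - X else 1 + C ((q : ℂ) - 1) * X := by
  have hsum : ∑ a : ZMod q, (ZMod.stdAddChar (b * a) : ℂ) = if b = 0 then (q : ℂ) else 0 := by
    have h := AddChar.sum_mulShift b (ZMod.isPrimitive_stdAddChar q)
    simp only [ZMod.card] at h
    simpa [mul_comm] using h
  have hterm (a : ZMod q) : C (ZMod.stdAddChar (b * a)) * (if a ≠ 0 then X else 1 : ℂ[X]) =
      C (ZMod.stdAddChar (b * a)) * X + if a = 0 then 1 - X else 0 := by
    split_ifs <;> simp_all
  simp only [hterm, Finset.sum_add_distrib, ← Finset.sum_mul, ← map_sum, hsum]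
  by_cases hb : b = 0
  · simp [hb]
    ring
  · simp [hb]

open Polynomial in
/-- The weight enumerator of the character `v ↦ ψ (u ⬝ v)` on `(ℤ/qℤ)^m`. -/
theorem sum_stdAddChar_mul_X_pow_hammingNorm {q m : ℕ} [NeZero q] (u : Fin m → ZMod q) :
    ∑ v : Fin m → ZMod q, C (ZMod.stdAddChar (∑ j, u j * v j)) * (X : ℂ[X]) ^ hammingNorm v =
      (1 - X) ^ hammingNorm u * (1 + C ((q : ℂ) - 1) * X) ^ (m - hammingNorm u) := by
  have hcard : (Finset.univ.filter fun j => ¬ u j ≠ 0).card = m - hammingNorm u := by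
    have h := Finset.card_filter_add_card_filter_not (s := Finset.univ) (fun j => u j ≠ 0)
    simp only [Finset.card_univ, Fintype.card_fin] at h
    unfold hammingNorm
    omega
  calc
    _ = ∑ v : Fin m → ZMod q, ∏ j,
        C (ZMod.stdAddChar (u j * v j)) * (if v j ≠ 0 then X else 1 : ℂ[X]) := by
      refine Finset.sum_congr rfl fun v _ => ?_
      rw [AddChar.map_sum_eq_prod, map_prod, Finset.prod_mul_distrib, ← Finset.prod_filter,
        Finset.prod_const, hammingNorm]
    _ = ∏ j, if u j ≠ 0 then (1 - X : ℂ[X]) else 1 + C ((q : ℂ) - 1) * X := by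
      simp_rw [← sum_stdAddChar_mul_weight]
      rw [Finset.prod_univ_sum, Fintype.piFinset_univ]
    _ = _ := by
      rw [Finset.prod_ite, Finset.prod_const, Finset.prod_const, hcard, hammingNorm]

open Polynomial in
theorem coeff_one_add_C_mul_X_pow {R : Type*} [CommRing R] (c : R) (n k : ℕ) :
    ((1 + C c * X) ^ n).coeff k = c ^ k * n.choose k := by
  have h : (1 + C c * X : R[X]) ^ n = ((1 + X) ^ n).comp (C c * X) := by simp
  rw [h, comp_C_mul_X_coeff, coeff_one_add_X_pow, mul_comm]

open Polynomial in
/-- The generating function of the Krawtchouk polynomials. -/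
theorem coeff_eq_krawtchouk (q t x m : ℕ) :
    ((1 - X) ^ x * (1 + C ((q : ℂ) - 1) * X) ^ (m - x)).coeff t = (krawtchouk q t x m : ℂ) := by
  have h : (1 - X : ℂ[X]) = 1 + C (-1) * X := by simp [sub_eq_add_neg]
  rw [h, coeff_mul, Finset.Nat.sum_antidiagonal_eq_sum_range_succ_mk, krawtchouk]
  push_cast
  refine Finset.sum_congr rfl fun j _ => ?_
  rw [coeff_one_add_C_mul_X_pow, coeff_one_add_C_mul_X_pow]
  ring

theorem exp_pow_val_eq_stdAddChar {q : ℕ} [NeZero q] (a : ZMod q) :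
    Complex.exp (2 * Real.pi * Complex.I / q) ^ a.val = ZMod.stdAddChar a := by
  rw [ZMod.stdAddChar_apply, ZMod.toCircle_apply, ← Complex.exp_nat_mul]
  congr 1
  ring

/-- For `u ∈ (ℤ/qℤ)^m` of Hamming weight `i`, the sum of `ζ_q^(u·v)` over all
vectors `v` of Hamming weight exactly `t` equals `K_t(i,m)`. -/
theorem stmt_4 (q m t : ℕ) [NeZero q] (hq : IsPrimePow q) (ht : t ≤ m)
    (u : Fin m → ZMod q) (i : ℕ) (hi : hammingNorm u = i) :
    ∑ v ∈ Finset.univ.filter (fun v : Fin m → ZMod q => hammingNorm v = t),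
        Complex.exp (2 * Real.pi * Complex.I / q) ^ (∑ j, u j * v j).val
      = (krawtchouk q t i m : ℂ) := by
  rw [← coeff_eq_krawtchouk, ← hi, ← sum_stdAddChar_mul_X_pow_hammingNorm,
    Polynomial.finsetSum_coeff, Finset.sum_filter]
  refine Finset.sum_congr rfl fun v _ => ?_
  rw [Polynomial.coeff_C_mul_X_pow, exp_pow_val_eq_stdAddChar]
  simp only [eq_comm]
end

section
/- Let q be a prime power and n a positive integer. For any vectors a, b in GF(q)^n, the following are equivalent: (i) b is covered by a; (ii) the sum over all c in GF(q)\{0} of the vectors (c*a) cap b equals b; (iii) the sum over all c in GF(q)\{0} of wt((c*a) cap b) equals wt(b). -/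
/-- For `a, b ∈ GF(q)^n`, `vcap a b` is the vector whose `i`-th coordinate is
`a i` when `a i = b i ≠ 0`, and `0` otherwise. -/
def vcap {F : Type*} [Zero F] [DecidableEq F] {n : ℕ} (a b : Fin n → F) : Fin n → F :=
  fun i => if a i = b i ∧ a i ≠ 0 then a i else 0

theorem sum_ite_mul_eq_and_ne_zero {F M : Type*} [Field F] [Fintype F] [DecidableEq F]
    [AddCommMonoid M] (a b : F) (x : M) :
    (∑ c ∈ (Finset.univ \ {0} : Finset F), if c * a = b ∧ c * a ≠ 0 then x else 0) =
      if a ≠ 0 ∧ b ≠ 0 then x else 0 := by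
  by_cases h : a ≠ 0 ∧ b ≠ 0
  · obtain ⟨ha, hb⟩ := h
    rw [Finset.sum_eq_single (b / a)]
    · simp [ha, hb]
    · intro c _ hc
      exact if_neg fun h => hc ((eq_div_iff ha).2 h.1)
    · intro h
      simp [ha, hb] at h
  · rw [if_neg h]
    refine Finset.sum_eq_zero fun c _ => if_neg ?_
    rintro ⟨rfl, hc⟩
    exact h ⟨right_ne_zero_of_mul hc, hc⟩

theorem sum_vcap_smul_apply {n : ℕ} {F : Type*} [Field F] [Fintype F] [DecidableEq F]
    (a b : Fin n → F) (i : Fin n) :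
    (∑ c ∈ (Finset.univ \ {0} : Finset F), vcap (c • a) b) i =
      if a i ≠ 0 ∧ b i ≠ 0 then b i else 0 := by
  rw [Finset.sum_apply, ← sum_ite_mul_eq_and_ne_zero]
  refine Finset.sum_congr rfl fun c _ => ?_
  simp only [vcap, Pi.smul_apply, smul_eq_mul]
  split_ifs with h
  · exact h.1
  · rfl

theorem sum_hammingNorm_vcap_smul {n : ℕ} {F : Type*} [Field F] [Fintype F] [DecidableEq F]
    (a b : Fin n → F) :
    (∑ c ∈ (Finset.univ \ {0} : Finset F), hammingNorm (vcap (c • a) b)) =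
      (Finset.univ.filter fun i => a i ≠ 0 ∧ b i ≠ 0).card := by
  simp only [hammingNorm, Finset.card_filter]
  rw [Finset.sum_comm]
  refine Finset.sum_congr rfl fun i _ => ?_
  rw [← sum_ite_mul_eq_and_ne_zero]
  refine Finset.sum_congr rfl fun c _ => if_congr ?_ rfl rfl
  simp only [vcap, Pi.smul_apply, smul_eq_mul, ne_eq, ite_eq_right_iff, Classical.not_imp]
  tauto

theorem covered_iff_sum_vcap_smul_eq {n : ℕ} {F : Type*} [Field F] [Fintype F] [DecidableEq F]
    (a b : Fin n → F) :
    (∀ i, b i ≠ 0 → a i ≠ 0) ↔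
      (∑ c ∈ (Finset.univ \ {0} : Finset F), vcap (c • a) b) = b := by
  rw [funext_iff]
  refine forall_congr' fun i => ?_
  rw [sum_vcap_smul_apply]
  grind

theorem covered_iff_sum_hammingNorm_vcap_smul_eq {n : ℕ} {F : Type*} [Field F] [Fintype F]
    [DecidableEq F] (a b : Fin n → F) :
    (∀ i, b i ≠ 0 → a i ≠ 0) ↔
      (∑ c ∈ (Finset.univ \ {0} : Finset F), hammingNorm (vcap (c • a) b)) = hammingNorm b := by
  rw [sum_hammingNorm_vcap_smul, hammingNorm]
  constructor
  · intro h
    congr 1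
    ext i
    simpa using h i
  · intro h i hi
    have hsub : (Finset.univ.filter fun i => a i ≠ 0 ∧ b i ≠ 0) ⊆
        Finset.univ.filter fun i => b i ≠ 0 :=
      Finset.monotone_filter_right _ fun _ _ h => h.2
    have hmem : i ∈ Finset.univ.filter fun i => a i ≠ 0 ∧ b i ≠ 0 := by
      rw [Finset.eq_of_subset_of_card_le hsub h.ge]
      simpa using hi
    exact (Finset.mem_filter.1 hmem).2.1

/-- `b ⪯ a` iff `∑_{c ≠ 0} (c•a) ∩ b = b` iff `∑_{c ≠ 0} wt((c•a) ∩ b) = wt(b)`. -/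
theorem stmt_5 {n : ℕ} {F : Type*} [Field F] [Fintype F] [DecidableEq F]
    (hn : 0 < n) (hq : IsPrimePow (Fintype.card F)) (a b : Fin n → F) :
    ((∀ i, b i ≠ 0 → a i ≠ 0) ↔ (∑ c ∈ (Finset.univ \ {0} : Finset F), vcap (c • a) b) = b) ∧
    ((∑ c ∈ (Finset.univ \ {0} : Finset F), vcap (c • a) b) = b ↔
      (∑ c ∈ (Finset.univ \ {0} : Finset F), hammingNorm (vcap (c • a) b)) = hammingNorm b) :=
  ⟨covered_iff_sum_vcap_smul_eq a b, (covered_iff_sum_vcap_smul_eq a b).symm.trans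
    (covered_iff_sum_hammingNorm_vcap_smul_eq a b)⟩
end

section
/- Let q be a prime power and n a positive integer. For any vectors a, b in GF(q)^n, one has (q-1)*(wt(a) + wt(b)) = (sum over c in GF(q)\{0} of wt(a + c*b)) + q * (sum over c in GF(q)\{0} of wt((c*a) cap b)). -/
theorem hammingNorm_eq_sum {ι F : Type*} [Fintype ι] [Zero F] [DecidableEq F] (v : ι → F) :
    hammingNorm v = ∑ i, if v i ≠ 0 then 1 else 0 := by
  simp only [hammingNorm, Finset.card_filter]

theorem vcap_apply_ne_zero_iff {F : Type*} [Zero F] [DecidableEq F] {n : ℕ} (a b : Fin n → F)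
    (i : Fin n) : vcap a b i ≠ 0 ↔ a i = b i ∧ a i ≠ 0 := by
  simp [vcap]

section Field

variable {F : Type*} [Field F] [Fintype F] [DecidableEq F] {x y : F}

theorem card_filter_add_mul_ne_zero (hx : x ≠ 0) (hy : y ≠ 0) :
    ((Finset.univ \ {0} : Finset F).filter fun c => x + c * y ≠ 0).card
      = Fintype.card F - 2 := by
  have h : ((Finset.univ \ {0} : Finset F).filter fun c => x + c * y ≠ 0)
      = Finset.univ \ {0, -x / y} := by
    ext c
    have : x + c * y = 0 ↔ c = -x / y := by
      rw [eq_div_iff hy, eq_neg_iff_add_eq_zero, add_comm]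
    simp [this]
  have hne : (0 : F) ≠ -x / y := (div_ne_zero (neg_ne_zero.mpr hx) hy).symm
  rw [h, Finset.card_sdiff_of_subset (Finset.subset_univ _), Finset.card_pair hne,
    Finset.card_univ]

theorem card_filter_mul_eq_and_ne_zero (hx : x ≠ 0) (hy : y ≠ 0) :
    ((Finset.univ \ {0} : Finset F).filter fun c => c * x = y ∧ c * x ≠ 0).card = 1 := by
  rw [Finset.card_eq_one]
  refine ⟨y / x, ?_⟩
  ext c
  have : c * x = y ↔ c = y / x := (eq_div_iff hx).symm
  simp only [Finset.mem_filter, Finset.mem_sdiff, Finset.mem_univ, Finset.mem_singleton, true_and,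
    this]
  constructor
  · exact fun h => h.2.1
  · rintro rfl
    simp [hx, hy]

theorem card_sub_one_mul_eq_sum (x y : F) :
    (Fintype.card F - 1) * ((if x ≠ 0 then 1 else 0) + if y ≠ 0 then 1 else 0)
      = (∑ c ∈ (Finset.univ \ {0} : Finset F), if x + c * y ≠ 0 then 1 else 0)
        + Fintype.card F *
          ∑ c ∈ (Finset.univ \ {0} : Finset F), if c * x = y ∧ c * x ≠ 0 then 1 else 0 := by
  have hcard : (Finset.univ \ {0} : Finset F).card = Fintype.card F - 1 := by
    rw [Finset.card_sdiff_of_subset (Finset.subset_univ _), Finset.card_singleton,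
      Finset.card_univ]
  simp only [← Finset.card_filter]
  by_cases hx : x = 0
  · subst hx
    by_cases hy : y = 0
    · simp [hy]
    · have h : ((Finset.univ \ {0} : Finset F).filter fun c => 0 + c * y ≠ 0)
          = Finset.univ \ {0} :=
        Finset.filter_true_of_mem fun c hc => by simpa [hy] using hc
      rw [h, hcard]
      simp [hy]
  · by_cases hy : y = 0
    · subst hy
      have h : ((Finset.univ \ {0} : Finset F).filter fun c => c * x = 0 ∧ c * x ≠ 0) = ∅ :=
        Finset.filter_false_of_mem fun c _ hc => hc.2 hc.1
      rw [h]
      simp [hx, hcard]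
    · rw [card_filter_add_mul_ne_zero hx hy, card_filter_mul_eq_and_ne_zero hx hy]
      have := Fintype.one_lt_card (α := F)
      simp only [ne_eq, hx, hy, not_false_eq_true, if_true]
      omega

end Field

/-- `(q-1)(wt(a)+wt(b)) = ∑_{c ≠ 0} wt(a + c•b) + q ∑_{c ≠ 0} wt((c•a) ∩ b)`. -/
theorem stmt_6 {n : ℕ} {F : Type*} [Field F] [Fintype F] [DecidableEq F]
    (hn : 0 < n) (hq : IsPrimePow (Fintype.card F)) (a b : Fin n → F) :
    (Fintype.card F - 1) * (hammingNorm a + hammingNorm b)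
      = (∑ c ∈ (Finset.univ \ {0} : Finset F), hammingNorm (a + c • b))
        + Fintype.card F * ∑ c ∈ (Finset.univ \ {0} : Finset F), hammingNorm (vcap (c • a) b) := by
  simp only [hammingNorm_eq_sum, vcap_apply_ne_zero_iff, Pi.add_apply, Pi.smul_apply, smul_eq_mul]
  rw [Finset.sum_comm, Finset.sum_comm (s := Finset.univ \ {0}), ← Finset.sum_add_distrib,
    Finset.mul_sum, Finset.mul_sum, ← Finset.sum_add_distrib]
  exact Finset.sum_congr rfl fun i _ => card_sub_one_mul_eq_sum (a i) (b i)
end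

section
/- Let q be a prime power and n a positive integer. For any vectors a, b in GF(q)^n, b is covered by a if and only if the sum over all c in GF(q)\{0} of wt(a + c*b) equals (q-1)*wt(a) - wt(b). -/
theorem hammingNorm_eq_sum_ite {ι R : Type*} [Fintype ι] [Zero R] [DecidableEq R] (x : ι → R) :
    (hammingNorm x : ℤ) = ∑ i, if x i ≠ 0 then 1 else 0 := by
  simp only [hammingNorm, Finset.sum_boole]

theorem sum_ite_add_mul_ne_zero {F : Type*} [Field F] [Fintype F] [DecidableEq F] (x y : F) :
    (∑ c : F, if x + c * y ≠ 0 then (1 : ℤ) else 0) =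
      if y = 0 then (Fintype.card F : ℤ) * (if x ≠ 0 then 1 else 0) else Fintype.card F - 1 := by
  split_ifs with hy hx
  · simp [hy, hx]
  · simp_all
  · have h (c : F) : (if x + c * y ≠ 0 then (1 : ℤ) else 0) = 1 - if c = -x / y then 1 else 0 := by
      have : x + c * y = 0 ↔ c = -x / y := by
        rw [eq_div_iff hy, add_comm, add_eq_zero_iff_eq_neg]
      simp only [ne_eq, this]
      split_ifs <;> simp_all
    simp [h]

theorem sum_ne_zero_ite_add_mul_ne_zero {F : Type*} [Field F] [Fintype F] [DecidableEq F]
    (x y : F) :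
    (∑ c ∈ (Finset.univ \ {0} : Finset F), if x + c * y ≠ 0 then (1 : ℤ) else 0) =
      ((Fintype.card F : ℤ) - 1) * (if x ≠ 0 then 1 else 0) - (if y ≠ 0 then 1 else 0) +
        Fintype.card F * (if y ≠ 0 ∧ x = 0 then 1 else 0) := by
  have h := Finset.sum_sdiff (Finset.subset_univ {(0 : F)})
    (f := fun c ↦ if x + c * y ≠ 0 then (1 : ℤ) else 0)
  rw [sum_ite_add_mul_ne_zero, Finset.sum_singleton, zero_mul, add_zero] at h
  by_cases hx : x = 0 <;> by_cases hy : y = 0 <;> simp [hx, hy] at h ⊢ <;> linarith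

theorem sum_hammingNorm_add_smul {ι F : Type*} [Fintype ι] [Field F] [Fintype F] [DecidableEq F]
    (a b : ι → F) :
    (∑ c ∈ (Finset.univ \ {0} : Finset F), (hammingNorm (a + c • b) : ℤ)) =
      ((Fintype.card F : ℤ) - 1) * hammingNorm a - hammingNorm b +
        Fintype.card F * ∑ i, if b i ≠ 0 ∧ a i = 0 then 1 else 0 := by
  simp_rw [hammingNorm_eq_sum_ite, Pi.add_apply, Pi.smul_apply, smul_eq_mul]
  rw [Finset.sum_comm]
  simp_rw [sum_ne_zero_ite_add_mul_ne_zero, Finset.sum_add_distrib, Finset.sum_sub_distrib,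
    Finset.mul_sum]

/-- `b ⪯ a` iff `∑_{c ≠ 0} wt(a + c•b) = (q-1)·wt(a) - wt(b)`. -/
theorem stmt_7 {n : ℕ} {F : Type*} [Field F] [Fintype F] [DecidableEq F]
    (hn : 0 < n) (hq : IsPrimePow (Fintype.card F)) (a b : Fin n → F) :
    (∀ i, b i ≠ 0 → a i ≠ 0) ↔
      (∑ c ∈ (Finset.univ \ {0} : Finset F), (hammingNorm (a + c • b) : ℤ))
        = ((Fintype.card F : ℤ) - 1) * hammingNorm a - hammingNorm b := by
  rw [sum_hammingNorm_add_smul, add_eq_left, mul_eq_zero,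
    Finset.sum_eq_zero_iff_of_nonneg fun i _ ↦ by split_ifs <;> simp]
  simp
end

section
/- Let m be a positive integer and let f be a function from GF(3)^m to GF(3) with f(0) = 0 such that for every w in GF(3)^m there exists x with f(x) different from w . x. Then the code C_f is a minimal linear code if and only if for all pairwise distinct vectors w_1, w_2, w_3 in GF(3)^m satisfying w_1 + w_2 + w_3 = 0, both Re(f^(w_1)) + Re(f^(w_2)) - 2*Re(f^(w_3)) != 3^m and Re(f^(w_1)) + Re(f^(w_2)) + Re(f^(w_3)) != 3^m hold. -/
/-- The codeword of `C_f` attached to `u ∈ GF(3)` and `v ∈ GF(3)^m`, indexed by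
the nonzero vectors of `GF(3)^m`. -/
def codeword (m : ℕ) (f : (Fin m → ZMod 3) → ZMod 3) (u : ZMod 3) (v : Fin m → ZMod 3) :
    {x : Fin m → ZMod 3 // x ≠ 0} → ZMod 3 :=
  fun x => u * f x.val + ∑ i, v i * x.val i

/-- The code `C_f` as a set of vectors indexed by `GF(3)^m \ {0}`. -/
def codeSet (m : ℕ) (f : (Fin m → ZMod 3) → ZMod 3) :
    Set ({x : Fin m → ZMod 3 // x ≠ 0} → ZMod 3) :=
  {c | ∃ u v, c = codeword m f u v}

/-- The Walsh transform `f^(w) = ∑_x ζ₃^(f(x) - w·x)`. -/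
noncomputable def walsh (m : ℕ) (f : (Fin m → ZMod 3) → ZMod 3) (w : Fin m → ZMod 3) : ℂ :=
  ∑ x : Fin m → ZMod 3,
    Complex.exp (2 * Real.pi * Complex.I / 3) ^ (f x - ∑ i, w i * x i).val

/-- The real part of `ζ₃ ^ z`. -/
noncomputable def reZeta (z : ZMod 3) : ℝ := if z = 0 then 1 else -1 / 2

/-- The real part of `∑_x ζ₃ ^ (u f(x) + v · x)`, the sum being over all of `GF(3)^m`. -/
noncomputable def reSum {m : ℕ} (f : (Fin m → ZMod 3) → ZMod 3) (u : ZMod 3)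
    (v : Fin m → ZMod 3) : ℝ :=
  ∑ x : Fin m → ZMod 3, reZeta (u * f x + ∑ i, v i * x i)

theorem re_exp_pow_val (z : ZMod 3) :
    (Complex.exp (2 * Real.pi * Complex.I / 3) ^ z.val).re = reZeta z := by
  have key (k : ℕ) : (Complex.exp (2 * Real.pi * Complex.I / 3) ^ k).re =
      Real.cos (k * (2 * Real.pi / 3)) := by
    rw [← Complex.exp_nat_mul, ← Complex.exp_ofReal_mul_I_re]
    congr 2
    push_cast
    ring
  have h1 : Real.cos (2 * Real.pi / 3) = -1 / 2 := by
    rw [show 2 * Real.pi / 3 = Real.pi - Real.pi / 3 by ring, Real.cos_pi_sub,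
      Real.cos_pi_div_three]
    norm_num
  have h2 : Real.cos (2 * (2 * Real.pi / 3)) = -1 / 2 := by
    rw [Real.cos_two_mul, h1]
    norm_num
  rw [key]
  obtain rfl | rfl | rfl : z = 0 ∨ z = 1 ∨ z = 2 := by revert z; decide
  · simp [reZeta]
  · rw [show (1 : ZMod 3).val = 1 from rfl, Nat.cast_one, one_mul, h1, reZeta,
      if_neg (by decide)]
  · rw [show (2 : ZMod 3).val = 2 from rfl, Nat.cast_ofNat, h2, reZeta, if_neg (by decide)]

theorem reZeta_neg (z : ZMod 3) : reZeta (-z) = reZeta z := by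
  simp [reZeta]

theorem reZeta_add_add (z : ZMod 3) : reZeta z + reZeta (z + 1) + reZeta (z + 2) = 0 := by
  obtain rfl | rfl | rfl : z = 0 ∨ z = 1 ∨ z = 2 := by revert z; decide
  all_goals
    simp only [reZeta, show (1 : ZMod 3) + 2 = 0 from rfl, show (2 : ZMod 3) + 1 = 0 from rfl,
      show (2 : ZMod 3) + 2 = 1 from rfl]
    norm_num [show (2 : ZMod 3) ≠ 0 by decide]

theorem sub_one_reZeta_eq (a b : ZMod 3) :
    1 - (reZeta (a + b) + reZeta (a - b) + reZeta b - 2 * reZeta a) =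
      if b ≠ 0 → a ≠ 0 then 0 else 9 / 2 := by
  have hcases : ∀ z : ZMod 3, z = 0 ∨ z = 1 ∨ z = -1 := by decide
  have h2 : (2 : ZMod 3) ≠ 0 := by decide
  rcases hcases a with rfl | rfl | rfl <;> rcases hcases b with rfl | rfl | rfl <;>
    simp only [reZeta] <;> norm_num [h2]

/-- In characteristic three, covering is detected by the sums of `reZeta`. -/
theorem covers_iff_sum_reZeta {ι : Type*} [Fintype ι] (a b : ι → ZMod 3) :
    (∀ x, b x ≠ 0 → a x ≠ 0) ↔
      ∑ x, reZeta (a x + b x) + ∑ x, reZeta (a x - b x) + ∑ x, reZeta (b x)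
        - 2 * ∑ x, reZeta (a x) = Fintype.card ι := by
  have hsum : (Fintype.card ι : ℝ) - (∑ x, reZeta (a x + b x) + ∑ x, reZeta (a x - b x) +
      ∑ x, reZeta (b x) - 2 * ∑ x, reZeta (a x)) =
        ∑ x, if b x ≠ 0 → a x ≠ 0 then (0 : ℝ) else 9 / 2 := by
    simp only [← sub_one_reZeta_eq, Finset.sum_sub_distrib, Finset.sum_add_distrib,
      Finset.mul_sum]
    simp
  rw [eq_comm, ← sub_eq_zero, hsum, Finset.sum_eq_zero_iff_of_nonneg]
  · refine forall_congr' fun x => ?_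
    by_cases h : b x ≠ 0 → a x ≠ 0 <;> simp [h]
  · intro x _
    positivity

section reSum

variable {m : ℕ} (f : (Fin m → ZMod 3) → ZMod 3)

theorem walsh_re (w : Fin m → ZMod 3) : (walsh m f w).re = reSum f 1 (-w) := by
  simp only [walsh, Complex.re_sum, re_exp_pow_val, reSum, Pi.neg_apply, neg_mul,
    Finset.sum_neg_distrib, one_mul, sub_eq_add_neg]

theorem reSum_neg (u : ZMod 3) (v : Fin m → ZMod 3) : reSum f (-u) (-v) = reSum f u v := by
  refine Finset.sum_congr rfl fun x _ => ?_
  rw [← reZeta_neg (u * f x + _), neg_add, ← Finset.sum_neg_distrib]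
  simp

theorem reSum_zero {v : Fin m → ZMod 3} (hv : v ≠ 0) : reSum f 0 v = 0 := by
  obtain ⟨i, hi⟩ := Function.ne_iff.mp hv
  have shift (c : ZMod 3) : reSum f 0 v =
      ∑ x : Fin m → ZMod 3, reZeta ((∑ j, v j * x j) + c) := by
    rw [reSum, ← Equiv.sum_comp (Equiv.addRight (Pi.single i ((v i)⁻¹ * c)))]
    refine Finset.sum_congr rfl fun x _ => ?_
    have : v i * ((v i)⁻¹ * c) = c := mul_inv_cancel_left₀ hi c
    simp [mul_add, Finset.sum_add_distrib, Pi.single_apply, this]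
  have h : reSum f 0 v + reSum f 0 v + reSum f 0 v = 0 := by
    have hs := congrArg₂ (· + ·) (congrArg₂ (· + ·) (shift 0) (shift 1)) (shift 2)
    refine hs.trans ?_
    simp only [← Finset.sum_add_distrib, add_zero, reZeta_add_add, Finset.sum_const_zero]
  linarith

variable {f}

theorem covers_iff_reSum (hf0 : f 0 = 0) (u u' : ZMod 3) (v v' : Fin m → ZMod 3) :
    (∀ x, codeword m f u' v' x ≠ 0 → codeword m f u v x ≠ 0) ↔
      reSum f (u + u') (v + v') + reSum f (u - u') (v - v') + reSum f u' v'
        - 2 * reSum f u v = 3 ^ m := by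
  have h := covers_iff_sum_reZeta (fun x : Fin m → ZMod 3 => u * f x + ∑ i, v i * x i)
    (fun x => u' * f x + ∑ i, v' i * x i)
  have hadd (x : Fin m → ZMod 3) : u * f x + ∑ i, v i * x i + (u' * f x + ∑ i, v' i * x i) =
      (u + u') * f x + ∑ i, (v + v') i * x i := by
    simp only [Pi.add_apply, add_mul, Finset.sum_add_distrib]
    ring
  have hsub (x : Fin m → ZMod 3) : u * f x + ∑ i, v i * x i - (u' * f x + ∑ i, v' i * x i) =
      (u - u') * f x + ∑ i, (v - v') i * x i := by
    simp only [Pi.sub_apply, sub_mul, Finset.sum_sub_distrib]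
    ring
  simp only [hadd, hsub] at h
  rw [show (Fintype.card (Fin m → ZMod 3) : ℝ) = 3 ^ m by simp] at h
  refine Iff.trans ⟨fun hx x hb => ?_, fun hx x => hx x.val⟩ h
  rcases eq_or_ne x 0 with rfl | hx0
  · simp [hf0] at hb
  · exact hx ⟨x, hx0⟩ hb

theorem codeword_eq_zero (hf0 : f 0 = 0) (hf : ∀ w : Fin m → ZMod 3, ∃ x, f x ≠ ∑ i, w i * x i)
    {u : ZMod 3} {v : Fin m → ZMod 3} (h : codeword m f u v = 0) : u = 0 ∧ v = 0 := by
  have h' (x : Fin m → ZMod 3) : u * f x + ∑ i, v i * x i = 0 := by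
    rcases eq_or_ne x 0 with rfl | hx
    · simp [hf0]
    · exact congrFun h ⟨x, hx⟩
  have hu : u = 0 := by
    by_contra hu
    obtain ⟨x, hx⟩ := hf (fun i => -u⁻¹ * v i)
    refine hx (mul_left_cancel₀ hu ?_)
    simp only [mul_assoc, ← Finset.mul_sum]
    rw [neg_mul, mul_neg, mul_inv_cancel_left₀ hu]
    exact eq_neg_of_add_eq_zero_left (h' x)
  refine ⟨hu, funext fun i => ?_⟩
  simpa [hu, Pi.single_apply] using h' (Pi.single i 1)

theorem smul_codeword (t u : ZMod 3) (v : Fin m → ZMod 3) :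
    t • codeword m f u v = codeword m f (t * u) (t • v) := by
  ext x
  simp [codeword, mul_add, Finset.mul_sum, mul_assoc]

theorem codeword_sub (u u' : ZMod 3) (v v' : Fin m → ZMod 3) :
    codeword m f u v - codeword m f u' v' = codeword m f (u - u') (v - v') := by
  ext x
  simp only [codeword, Pi.sub_apply, sub_mul, Finset.sum_sub_distrib]
  ring

theorem codeword_eq_smul (hf0 : f 0 = 0)
    (hf : ∀ w : Fin m → ZMod 3, ∃ x, f x ≠ ∑ i, w i * x i)
    {t u u' : ZMod 3} {v v' : Fin m → ZMod 3} (h : codeword m f u' v' = t • codeword m f u v) :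
    u' = t * u ∧ v' = t • v := by
  rw [smul_codeword, ← sub_eq_zero, codeword_sub] at h
  simpa only [sub_eq_zero] using codeword_eq_zero hf0 hf h

theorem three_eq_zero : (3 : Fin m → ZMod 3) = 0 := funext fun _ => rfl

/-- If the sums of `f` avoid the two exceptional configurations, then covering implies
proportionality of the parameters of the codewords. -/
theorem exists_smul_of_reSum
    (H : ∀ w₁ w₂ w₃ : Fin m → ZMod 3, w₁ ≠ w₂ → w₁ + w₂ + w₃ = 0 →
      reSum f 1 w₁ + reSum f 1 w₂ - 2 * reSum f 1 w₃ ≠ 3 ^ m ∧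
      reSum f 1 w₁ + reSum f 1 w₂ + reSum f 1 w₃ ≠ 3 ^ m)
    {u u' : ZMod 3} {v v' : Fin m → ZMod 3} (hne : u ≠ 0 ∨ v ≠ 0)
    (h : reSum f (u + u') (v + v') + reSum f (u - u') (v - v') + reSum f u' v'
        - 2 * reSum f u v = 3 ^ m) :
    ∃ t : ZMod 3, u' = t * u ∧ v' = t • v := by
  have h3 := three_eq_zero (m := m)
  have hcases : ∀ z : ZMod 3, z = 0 ∨ z = 1 ∨ z = -1 := by decide
  have hpos : (0 : ℝ) < 3 ^ m := by positivity
  wlog hu : u = 0 ∨ u = 1 generalizing u u' v v'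
  · obtain rfl : u = -1 := by have := hcases u; tauto
    obtain ⟨t, h1, h2⟩ := this (u := 1) (u' := -u') (v := -v) (v' := -v')
      (Or.inl one_ne_zero) (by
        rw [← reSum_neg f (1 + -u'), ← reSum_neg f (1 - -u'), ← reSum_neg f 1 (-v), reSum_neg f u']
        convert h using 4 <;> ring_nf) (Or.inr rfl)
    exact ⟨t, by linear_combination -h1, by rw [smul_neg] at h2; exact neg_injective h2⟩
  wlog hu' : u' = 0 ∨ u' = 1 generalizing u' v'
  · obtain rfl : u' = -1 := by have := hcases u'; tauto
    obtain ⟨t, h1, h2⟩ := this (u' := 1) (v' := -v') (by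
        rw [← reSum_neg f 1 (-v'), neg_neg, ← sub_eq_add_neg, sub_neg_eq_add]
        rw [sub_neg_eq_add, ← sub_eq_add_neg] at h
        linarith) (Or.inr rfl)
    exact ⟨-t, by linear_combination -h1, by rw [neg_smul, ← h2, neg_neg]⟩
  rcases hu with rfl | rfl <;> rcases hu' with rfl | rfl
  · by_contra! hcon
    have hv' : v' ≠ 0 := by simpa using hcon 0
    have hsub : v - v' ≠ 0 := by simpa [sub_eq_zero, eq_comm] using hcon 1
    have hadd : v + v' ≠ 0 := fun h0 =>
      hcon (-1) (by simp) (by rw [neg_one_smul]; linear_combination h0)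
    have hv : v ≠ 0 := by simpa using hne
    rw [add_zero, sub_zero, reSum_zero f hv, reSum_zero f hv', reSum_zero f hsub,
      reSum_zero f hadd] at h
    linarith
  · have hv : v ≠ 0 := by simpa using hne
    refine absurd ?_ (H (v + v') (v' - v) v' (fun h0 => hv ?_) ?_).2
    · rw [zero_add, zero_sub, ← reSum_neg f (-1) (v - v'), neg_neg, neg_sub,
        reSum_zero f hv] at h
      linarith
    · linear_combination v * h3 - h0
    · linear_combination v' * h3
  · rcases eq_or_ne v' 0 with rfl | hv'
    · exact ⟨0, by simp⟩
    refine absurd ?_ (H (v + v') (v - v') v (fun h0 => hv' ?_) ?_).1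
    · rw [add_zero, sub_zero, reSum_zero f hv'] at h
      linarith
    · linear_combination v' * h3 - h0
    · linear_combination v * h3
  · rcases eq_or_ne v v' with rfl | hv
    · exact ⟨1, by simp⟩
    refine absurd ?_ (H (-v - v') v' v (fun h0 => hv ?_) ?_).1
    · rw [← reSum_neg f (1 + 1), sub_self, reSum_zero f (sub_ne_zero.mpr hv), neg_add' v v',
        show -(1 + 1 : ZMod 3) = 1 from rfl] at h
      linarith
    · linear_combination -h0 - v' * h3
    · ring

end reSum

/-- `C_f` is minimal iff for all pairwise distinct `w₁, w₂, w₃` summing to `0`,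
`Re f^(w₁) + Re f^(w₂) - 2 Re f^(w₃) ≠ 3^m` and
`Re f^(w₁) + Re f^(w₂) + Re f^(w₃) ≠ 3^m`. -/
theorem stmt_12 (m : ℕ) (hm : 1 ≤ m) (f : (Fin m → ZMod 3) → ZMod 3) (hf0 : f 0 = 0)
    (hf : ∀ w : Fin m → ZMod 3, ∃ x, f x ≠ ∑ i, w i * x i) :
    (∀ a ∈ codeSet m f, ∀ b ∈ codeSet m f,
        (∀ x, b x ≠ 0 → a x ≠ 0) → ∃ t : ZMod 3, b = t • a) ↔
      ∀ w₁ w₂ w₃ : Fin m → ZMod 3, w₁ ≠ w₂ → w₁ ≠ w₃ → w₂ ≠ w₃ → w₁ + w₂ + w₃ = 0 →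
        ((walsh m f w₁).re + (walsh m f w₂).re - 2 * (walsh m f w₃).re ≠ (3 : ℝ) ^ m ∧
         (walsh m f w₁).re + (walsh m f w₂).re + (walsh m f w₃).re ≠ (3 : ℝ) ^ m) := by
  have h3 := three_eq_zero (m := m)
  simp only [walsh_re]
  constructor
  · intro hmin w₁ w₂ w₃ _ h13 _ hw
    have hmin' (u u' : ZMod 3) (v v' : Fin m → ZMod 3)
        (h : reSum f (u + u') (v + v') + reSum f (u - u') (v - v') + reSum f u' v'
          - 2 * reSum f u v = 3 ^ m) : ∃ t : ZMod 3, u' = t * u ∧ v' = t • v := by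
      obtain ⟨t, ht⟩ := hmin _ ⟨u, v, rfl⟩ _ ⟨u', v', rfl⟩
        ((covers_iff_reSum hf0 u u' v v').mpr h)
      exact ⟨t, codeword_eq_smul hf0 hf ht⟩
    have hz := reSum_zero f (sub_ne_zero.mpr h13)
    have e1 : -w₃ + (w₁ - w₃) = -w₂ := by linear_combination hw - w₃ * h3
    have e2 : -w₃ - (w₁ - w₃) = -w₁ := by ring
    constructor
    · intro h
      obtain ⟨t, h1, h2⟩ := hmin' 1 0 (-w₃) (w₁ - w₃) (by
        rw [e1, e2, hz, add_zero, sub_zero, add_zero]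
        linarith)
      obtain rfl : t = 0 := by simpa using h1.symm
      exact h13 (by simpa [sub_eq_zero] using h2)
    · intro h
      obtain ⟨t, h1, -⟩ := hmin' 0 1 (w₁ - w₃) (-w₃) (by
        rw [add_comm (w₁ - w₃), e1, ← reSum_neg f (0 - 1), neg_sub (w₁ - w₃), e2, hz, zero_add,
          zero_sub, neg_neg]
        linarith)
      simp at h1
  · rintro H _ ⟨u, v, rfl⟩ _ ⟨u', v', rfl⟩ hcov
    by_cases hne : u = 0 ∧ v = 0
    · obtain ⟨rfl, rfl⟩ := hne
      refine ⟨0, funext fun x => ?_⟩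
      by_contra hx
      exact hcov x (by simpa using hx) (by simp [codeword])
    · obtain ⟨t, rfl, rfl⟩ := exists_smul_of_reSum (f := f) (u := u) (u' := u') (v := v) (v' := v')
        (fun w₁ w₂ w₃ h12 hw => by
          simpa only [neg_neg] using H (-w₁) (-w₂) (-w₃) (fun h0 => h12 (neg_injective h0))
            (fun h0 => h12 (by linear_combination -hw + h0 + w₁ * h3))
            (fun h0 => h12 (by linear_combination hw - h0 - w₂ * h3))
            (by linear_combination -hw))
        (by tauto) ((covers_iff_reSum hf0 u u' v v').mp hcov)
      exact ⟨t, (smul_codeword t u v).symm⟩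
end

section
/- Let m and k be integers with m >= 5 and 2 <= k <= floor((m-1)/2), and let g_{(m,k)} be the function from GF(3)^m to GF(3) taking value 1 on vectors of Hamming weight between 1 and k and value 0 otherwise. Then the minimum nonzero Hamming weight of the linear code C_{g_{(m,k)}} equals sum over j from 1 to k of 2^j * binomial(m,j). -/
/-- `g_{(m,k)} : GF(3)^m → GF(3)` takes value `1` on the vectors of Hamming
weight between `1` and `k`, and `0` otherwise. -/
def gmk (m k : ℕ) : (Fin m → ZMod 3) → ZMod 3 :=
  fun x => if 1 ≤ hammingNorm x ∧ hammingNorm x ≤ k then 1 else 0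

theorem card_filter_hammingNorm_eq (m j : ℕ) :
    (Finset.univ.filter fun x : Fin m → ZMod 3 => hammingNorm x = j).card
      = 2 ^ j * m.choose j := by
  have support_fiber : ∀ S : Finset (Fin m),
      (Finset.univ.filter fun x : Fin m → ZMod 3 =>
        (Finset.univ.filter fun i => x i ≠ 0) = S).card = 2 ^ S.card := by
    intro S
    have h : (Finset.univ.filter fun x : Fin m → ZMod 3 =>
        (Finset.univ.filter fun i => x i ≠ 0) = S)
        = Fintype.piFinset fun i => if i ∈ S then ({1, 2} : Finset (ZMod 3)) else {0} := by
      have hz : ∀ a : ZMod 3, a ≠ 0 ↔ a = 1 ∨ a = 2 := by decide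
      ext x
      simp only [Finset.mem_filter, Finset.mem_univ, true_and, Fintype.mem_piFinset,
        Finset.ext_iff]
      refine forall_congr' fun i => ?_
      by_cases hi : i ∈ S
      · simp [hi, hz]
      · simp [hi]
    have h2 : ({1, 2} : Finset (ZMod 3)).card = 2 := by decide
    rw [h, Fintype.card_piFinset]
    simp [apply_ite Finset.card, h2]
  rw [Finset.card_eq_sum_card_fiberwise
    (f := fun x : Fin m → ZMod 3 => Finset.univ.filter fun i => x i ≠ 0)
    (t := Finset.powersetCard j Finset.univ)]
  · rw [Finset.sum_congr rfl (g := fun _ => 2 ^ j)]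
    · simp [mul_comm]
    · intro S hS
      have hS' := (Finset.mem_powersetCard.1 hS).2
      rw [← hS', ← support_fiber S, Finset.filter_filter]
      congr 1
      ext x
      simp only [Finset.mem_filter, Finset.mem_univ, true_and, and_iff_right_iff_imp]
      rintro rfl
      rfl
  · intro x hx
    simpa [Finset.mem_powersetCard, hammingNorm] using hx

theorem hammingNorm_subtype_ne_zero {m : ℕ} (h : (Fin m → ZMod 3) → ZMod 3) (h0 : h 0 = 0) :
    hammingNorm (fun x : {x : Fin m → ZMod 3 // x ≠ 0} => h x.val)
      = (Finset.univ.filter fun x => h x ≠ 0).card := by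
  rw [hammingNorm, ← Finset.card_map (Function.Embedding.subtype _)]
  congr 1
  ext x
  simp only [Finset.mem_map, Finset.mem_filter, Finset.mem_univ, true_and,
    Function.Embedding.subtype_apply, Subtype.exists, exists_and_left, exists_prop,
    exists_eq_right_right, and_iff_left_iff_imp]
  rintro hx rfl
  exact hx h0

theorem card_filter_gmk_ne_zero (m k : ℕ) :
    (Finset.univ.filter fun x => gmk m k x ≠ 0).card
      = ∑ j ∈ Finset.Icc 1 k, 2 ^ j * m.choose j := by
  rw [Finset.card_eq_sum_card_fiberwise (f := fun x => hammingNorm x) (t := Finset.Icc 1 k)]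
  · refine Finset.sum_congr rfl fun j hj => ?_
    rw [← card_filter_hammingNorm_eq, Finset.filter_filter]
    congr 1
    ext x
    have := Finset.mem_Icc.1 hj
    simp only [Finset.mem_filter, Finset.mem_univ, true_and, and_iff_right_iff_imp]
    rintro rfl
    simp [gmk, this]
  · intro x hx
    simpa [gmk] using hx

theorem three_mul_sum_le {m k : ℕ} (hk : 2 * k < m) :
    3 * ∑ j ∈ Finset.Icc 1 k, 2 ^ j * m.choose j ≤ 3 ^ m := by
  have hrefl : 2 * ∑ j ∈ Finset.Icc 1 k, 2 ^ j * m.choose j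
      ≤ ∑ j ∈ (Finset.Icc 1 k).image (fun j => m - j), 2 ^ j * m.choose j := by
    rw [Finset.sum_image, Finset.mul_sum]
    · refine Finset.sum_le_sum fun j hj => ?_
      have := Finset.mem_Icc.1 hj
      rw [Nat.choose_symm (by omega), ← mul_assoc, ← pow_succ']
      gcongr <;> omega
    · intro a ha b hb hab
      have := Finset.mem_Icc.1 ha
      have := Finset.mem_Icc.1 hb
      dsimp only at hab
      omega
  have hdisj : Disjoint (Finset.Icc 1 k) ((Finset.Icc 1 k).image (fun j => m - j)) := by
    rw [Finset.disjoint_left]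
    intro a ha hb
    obtain ⟨b, hb', rfl⟩ := Finset.mem_image.1 hb
    have := Finset.mem_Icc.1 hb'
    have := Finset.mem_Icc.1 ha
    omega
  calc 3 * ∑ j ∈ Finset.Icc 1 k, 2 ^ j * m.choose j
      ≤ ∑ j ∈ Finset.Icc 1 k ∪ (Finset.Icc 1 k).image (fun j => m - j), 2 ^ j * m.choose j := by
        rw [Finset.sum_union hdisj]
        omega
    _ ≤ ∑ j ∈ Finset.range (m + 1), 2 ^ j * m.choose j := by
        refine Finset.sum_le_sum_of_subset fun j hj => ?_
        simp only [Finset.mem_union, Finset.mem_image, Finset.mem_Icc, Finset.mem_range] at hj ⊢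
        omega
    _ = 3 ^ m := by
        have := add_pow 2 1 m
        simpa using this.symm

theorem three_mul_card_filter_dot_ne_zero {m : ℕ} {v : Fin m → ZMod 3} (hv : v ≠ 0) :
    3 * (Finset.univ.filter fun x : Fin m → ZMod 3 => ∑ i, v i * x i ≠ 0).card = 2 * 3 ^ m := by
  have : Fact (Nat.Prime 3) := ⟨Nat.prime_three⟩
  obtain ⟨i, hi⟩ := Function.ne_iff.1 hv
  let φ : (Fin m → ZMod 3) →+ ZMod 3 :=
    { toFun := fun x => ∑ i, v i * x i
      map_zero' := by simp
      map_add' := by simp [mul_add, Finset.sum_add_distrib] }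
  have hsurj : Function.Surjective φ := by
    intro a
    refine ⟨Pi.single i ((v i)⁻¹ * a), ?_⟩
    simp [φ, Pi.single_apply, mul_inv_cancel_left₀ hi]
  have hker := φ.ker.card_mul_index
  rw [AddSubgroup.index_ker, AddMonoidHom.range_eq_top.2 hsurj] at hker
  have hcard : Nat.card φ.ker
      = (Finset.univ.filter fun x : Fin m → ZMod 3 => ∑ i, v i * x i = 0).card := by
    rw [← Fintype.card_subtype, ← Nat.card_eq_fintype_card]
    rfl
  have hsum := Finset.card_filter_add_card_filter_not (s := Finset.univ)
    (fun x : Fin m → ZMod 3 => ∑ i, v i * x i = 0)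
  simp only [hcard, AddSubgroup.card_top, Nat.card_eq_fintype_card, Fintype.card_pi, ZMod.card,
    Finset.prod_const, Finset.card_univ, Fintype.card_fin] at hker hsum
  simp only [ne_eq]
  omega

theorem hammingNorm_gmk_part (m k : ℕ) {u : ZMod 3} (hu : u ≠ 0) :
    hammingNorm (fun x : {x : Fin m → ZMod 3 // x ≠ 0} => u * gmk m k x.val)
      = ∑ j ∈ Finset.Icc 1 k, 2 ^ j * m.choose j := by
  have : Fact (Nat.Prime 3) := ⟨Nat.prime_three⟩
  rw [hammingNorm_subtype_ne_zero (fun x => u * gmk m k x) (by simp [gmk]),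
    ← card_filter_gmk_ne_zero]
  simp [hu]

theorem hammingNorm_codeword_zero_right (m k : ℕ) {u : ZMod 3} (hu : u ≠ 0) :
    hammingNorm (codeword m (gmk m k) u 0) = ∑ j ∈ Finset.Icc 1 k, 2 ^ j * m.choose j := by
  rw [← hammingNorm_gmk_part m k hu]
  simp [hammingNorm, codeword]

theorem sum_le_hammingNorm_codeword {m k : ℕ} (hk : 2 * k < m) {u : ZMod 3}
    {v : Fin m → ZMod 3} (hc : codeword m (gmk m k) u v ≠ 0) :
    ∑ j ∈ Finset.Icc 1 k, 2 ^ j * m.choose j ≤ hammingNorm (codeword m (gmk m k) u v) := by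
  rcases eq_or_ne v 0 with rfl | hv
  · have hu : u ≠ 0 := by
      rintro rfl
      exact hc (by ext x; simp [codeword])
    exact (hammingNorm_codeword_zero_right m k hu).ge
  · have hdot := hammingNorm_subtype_ne_zero (m := m) (fun x => ∑ i, v i * x i) (by simp)
    have hcard := three_mul_card_filter_dot_ne_zero hv
    have hball := three_mul_sum_le hk
    have hg : hammingNorm (fun x : {x : Fin m → ZMod 3 // x ≠ 0} => u * gmk m k x.val)
        ≤ ∑ j ∈ Finset.Icc 1 k, 2 ^ j * m.choose j := by
      rcases eq_or_ne u 0 with rfl | hu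
      · simp [hammingNorm]
      · exact (hammingNorm_gmk_part m k hu).le
    have htri : hammingNorm (fun x : {x : Fin m → ZMod 3 // x ≠ 0} => ∑ i, v i * x.val i)
        ≤ hammingNorm (fun x : {x : Fin m → ZMod 3 // x ≠ 0} => u * gmk m k x.val)
          + hammingNorm (codeword m (gmk m k) u v) := by
      have h := hammingDist_triangle_right (codeword m (gmk m k) u v)
        (fun x : {x : Fin m → ZMod 3 // x ≠ 0} => u * gmk m k x.val) 0
      rw [hammingDist_zero_right, hammingDist_zero_right, add_comm] at h
      refine le_of_eq_of_le ?_ h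
      simp [hammingNorm, hammingDist, codeword]
    omega

/-- For `m ≥ 5` and `2 ≤ k ≤ ⌊(m-1)/2⌋`, the minimum nonzero Hamming weight of
the code `C_{g_{(m,k)}}` equals `∑_{j=1}^k 2^j·C(m,j)`. -/
theorem stmt_14 (m k : ℕ) (hm : 5 ≤ m) (hk2 : 2 ≤ k) (hk : k ≤ (m - 1) / 2) :
    sInf {w : ℕ | ∃ c ∈ codeSet m (gmk m k), c ≠ 0 ∧ hammingNorm c = w}
      = ∑ j ∈ Finset.Icc 1 k, 2 ^ j * m.choose j := by
  have hkm : 2 * k < m := by omega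
  refine IsLeast.csInf_eq ⟨⟨_, ⟨1, 0, rfl⟩, ?_⟩, ?_⟩
  · have hw := hammingNorm_codeword_zero_right m k (u := 1) one_ne_zero
    refine ⟨?_, hw⟩
    rw [← hammingNorm_pos_iff, hw]
    refine Finset.sum_pos (fun j hj => ?_) ⟨1, Finset.mem_Icc.2 (by omega)⟩
    have := Nat.choose_pos (n := m) (k := j) (by have := Finset.mem_Icc.1 hj; omega)
    positivity
  · rintro w ⟨_, ⟨u, v, rfl⟩, hc, rfl⟩
    exact sum_le_hammingNorm_codeword hkm hc
end

section
/- Let m and k be integers with m >= 5 and 2 <= k <= floor((m-1)/2), and let g_{(m,k)} be the function from GF(3)^m to GF(3) taking value 1 on vectors of Hamming weight between 1 and k and value 0 otherwise. Then the maximum Hamming weight of a codeword of the linear code C_{g_{(m,k)}} equals 3^m - 3^(m-1) + 2^k * binomial(m-1,k) - 1. -/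
open Finset

lemma hammingNorm_insertNth {n : ℕ} (i : Fin (n + 1)) (t : ZMod 3) (y : Fin n → ZMod 3) :
    hammingNorm (i.insertNth t y : Fin (n + 1) → ZMod 3)
      = (if t = 0 then 0 else 1) + hammingNorm y := by
  simp only [hammingNorm, Finset.card_filter, Fin.sum_univ_succAbove _ i,
    Fin.insertNth_apply_same, Fin.insertNth_apply_succAbove]
  split_ifs <;> simp_all

/-- Summation over `GF(3)^(n+1)` along lines parallel to the `i`-th axis. -/
lemma sum_eq_sum_insertNth {n : ℕ} (i : Fin (n + 1)) (F : (Fin (n + 1) → ZMod 3) → ℕ) :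
    ∑ x, F x = ∑ y : Fin n → ZMod 3, ∑ t : ZMod 3, F (i.insertNth t y) := by
  rw [← (Fin.insertNthEquiv (fun _ => ZMod 3) i).sum_comp, Fintype.sum_prod_type_right]
  rfl

/-- The size of a Hamming sphere in `GF(3)^n`. -/
lemma sum_hammingNorm_eq (n k : ℕ) :
    ∑ y : Fin n → ZMod 3, (if hammingNorm y = k then 1 else 0) = 2 ^ k * n.choose k := by
  induction n generalizing k with
  | zero => cases k <;> simp [hammingNorm]
  | succ n ih =>
    rw [sum_eq_sum_insertNth 0]
    have hsplit (y : Fin n → ZMod 3) :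
        ∑ t : ZMod 3, (if hammingNorm (Fin.insertNth 0 t y : Fin (n + 1) → ZMod 3) = k
          then 1 else 0)
        = (if hammingNorm y = k then 1 else 0) + 2 * (if 1 + hammingNorm y = k then 1 else 0) := by
      simp only [hammingNorm_insertNth]
      rw [← Finset.add_sum_erase _ _ (Finset.mem_univ 0), if_pos rfl, zero_add]
      congr 1
      rw [Finset.sum_congr rfl fun t ht => by rw [if_neg (Finset.ne_of_mem_erase ht)]]
      simp [ZMod.card]
    simp only [hsplit, Finset.sum_add_distrib, ← Finset.mul_sum, ih]
    cases k with
    | zero => simp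
    | succ k =>
      simp only [add_comm 1, Nat.add_right_cancel_iff, ih, Nat.choose_succ_succ]
      ring

/-- At most half of the vectors of `GF(3)^n` have weight below `k ≤ n / 2`: adding the all-one
vector moves the ball off itself. -/
lemma two_mul_sum_hammingNorm_lt_le {n k : ℕ} (hk : 2 * k ≤ n) :
    2 * ∑ y : Fin n → ZMod 3, (if hammingNorm y < k then 1 else 0) ≤ 3 ^ n := by
  have hsum (y : Fin n → ZMod 3) : n ≤ hammingNorm y + hammingNorm (y + 1) := by
    simp only [hammingNorm, Finset.card_filter, ← Finset.sum_add_distrib]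
    calc n = ∑ _i : Fin n, 1 := by simp
      _ ≤ _ := Finset.sum_le_sum fun i _ => by
        by_cases h : y i = 0 <;> simp [h]
  have hshift : ∑ y : Fin n → ZMod 3, (if hammingNorm y < k then 1 else 0)
      = ∑ y : Fin n → ZMod 3, (if hammingNorm (y + 1) < k then 1 else 0) :=
    (Equiv.sum_comp (Equiv.addRight (1 : Fin n → ZMod 3))
      fun y => if hammingNorm y < k then 1 else 0).symm
  calc 2 * ∑ y : Fin n → ZMod 3, (if hammingNorm y < k then 1 else 0)
      = ∑ y : Fin n → ZMod 3, ((if hammingNorm y < k then 1 else 0)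
          + (if hammingNorm (y + 1) < k then 1 else 0)) := by
        rw [Finset.sum_add_distrib, ← hshift, two_mul]
    _ ≤ ∑ _y : Fin n → ZMod 3, 1 := Finset.sum_le_sum fun y _ => by
        have := hsum y
        split_ifs <;> omega
    _ = 3 ^ n := by simp [ZMod.card]

/-- Number of nonzero entries of a codeword on a line with direction coefficient `a` and offset
`s`, where the support of the function meets the line at `t = 0` iff `p` and at `t ≠ 0` iff `q`. -/
def lineWeight (u a s : ZMod 3) (p q : Prop) [Decidable p] [Decidable q] : ℕ :=
  ∑ t : ZMod 3,
    if u * (if (if t = 0 then p else q) then 1 else 0) + (a * t + s) ≠ 0 then 1 else 0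

lemma lineWeight_le_three (u a s : ZMod 3) (p q : Prop) [Decidable p] [Decidable q] :
    lineWeight u a s p q ≤ 3 :=
  (Finset.sum_le_sum (g := fun _ => 1) fun t _ => by split_ifs <;> simp).trans
    (by simp [ZMod.card] : ∑ _t : ZMod 3, 1 ≤ 3)

lemma lineWeight_congr (u a s : ZMod 3) {p q p' q' : Prop} [Decidable p] [Decidable q]
    [Decidable p'] [Decidable q'] (hp : p ↔ p') (hq : q ↔ q') :
    lineWeight u a s p q = lineWeight u a s p' q' := by
  simp only [lineWeight, hp, hq]

lemma hammingNorm_codeword {n k : ℕ} (i : Fin (n + 1)) (u : ZMod 3) (v : Fin (n + 1) → ZMod 3) :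
    hammingNorm (codeword (n + 1) (gmk (n + 1) k) u v)
      = ∑ y : Fin n → ZMod 3, lineWeight u (v i) (∑ j, v (i.succAbove j) * y j)
          (1 ≤ hammingNorm y ∧ hammingNorm y ≤ k) (hammingNorm y < k) := by
  have htotal : hammingNorm (codeword (n + 1) (gmk (n + 1) k) u v)
      = ∑ x, if u * gmk (n + 1) k x + ∑ j, v j * x j ≠ 0 then 1 else 0 := by
    rw [hammingNorm, Finset.card_filter]
    refine Eq.trans ?_ (Finset.sum_filter_of_ne (p := fun x => x ≠ 0) ?_)
    · exact (Finset.sum_subtype _ (by simp)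
        fun x => if u * gmk (n + 1) k x + ∑ j, v j * x j ≠ 0 then 1 else 0).symm
    · rintro x - hx rfl
      simp [gmk] at hx
  rw [htotal, sum_eq_sum_insertNth i]
  refine Finset.sum_congr rfl fun y _ => Finset.sum_congr rfl fun t _ => ?_
  simp only [gmk, hammingNorm_insertNth, Fin.sum_univ_succAbove _ i, Fin.insertNth_apply_same,
    Fin.insertNth_apply_succAbove]
  by_cases ht : t = 0
  · simp [ht]
  · simp [ht, Nat.lt_iff_add_one_le, add_comm]

section Weights

variable {n k : ℕ} {u : ZMod 3} {v : Fin (n + 1) → ZMod 3}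

lemma lineWeight_add_le {a s : ZMod 3} {y : Fin n → ZMod 3} (hk : 0 < k) (hu : u ≠ 0)
    (ha : a ≠ 0) (hs : y = 0 → s = 0) :
    lineWeight u a s (1 ≤ hammingNorm y ∧ hammingNorm y ≤ k) (hammingNorm y < k)
        + (if y = 0 then 1 else 0)
      ≤ 2 + (if hammingNorm y = k then 1 else 0) := by
  by_cases hy : y = 0
  · rw [hs hy, lineWeight_congr (p' := False) (q' := True) _ _ _ (by simp [hy]) (by simp [hy, hk])]
    have : ∀ u a : ZMod 3, u ≠ 0 → a ≠ 0 → lineWeight u a 0 False True = 1 := by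
      unfold lineWeight; decide
    simp [this u a hu ha, hy]
  have hpos : 1 ≤ hammingNorm y := Nat.one_le_iff_ne_zero.2 (by simpa using hy)
  rcases lt_trichotomy (hammingNorm y) k with h | h | h
  · rw [lineWeight_congr (p' := True) (q' := True) _ _ _ (by simp; omega) (by simp; omega)]
    have : ∀ u a s : ZMod 3, a ≠ 0 → lineWeight u a s True True = 2 := by
      unfold lineWeight; decide
    simp [this u a s ha, hy]
  · simpa [hy, h] using lineWeight_le_three u a s _ _
  · rw [lineWeight_congr (p' := False) (q' := False) _ _ _ (by simp; omega) (by simp; omega)]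
    have : ∀ u a s : ZMod 3, a ≠ 0 → lineWeight u a s False False = 2 := by
      unfold lineWeight; decide
    simp [this u a s ha, hy]

lemma lineWeight_axis_add (y : Fin n → ZMod 3) (hk : 0 < k) :
    lineWeight 1 1 0 (1 ≤ hammingNorm y ∧ hammingNorm y ≤ k) (hammingNorm y < k)
        + (if y = 0 then 1 else 0)
      = 2 + (if hammingNorm y = k then 1 else 0) := by
  by_cases hy : y = 0
  · rw [lineWeight_congr (p' := False) (q' := True) _ _ _ (by simp [hy]) (by simp [hy, hk])]
    have : lineWeight 1 1 0 False True = 1 := by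
      unfold lineWeight; decide
    simp [this, hy, hk.ne]
  have hpos : 1 ≤ hammingNorm y := Nat.one_le_iff_ne_zero.2 (by simpa using hy)
  rcases lt_trichotomy (hammingNorm y) k with h | h | h
  · rw [lineWeight_congr (p' := True) (q' := True) _ _ _ (by simp; omega) (by simp; omega)]
    have : lineWeight 1 1 0 True True = 2 := by
      unfold lineWeight; decide
    simp [this, hy, h.ne]
  · rw [lineWeight_congr (p' := True) (q' := False) _ _ _ (by simp; omega) (by simp; omega)]
    have : lineWeight 1 1 0 True False = 3 := by
      unfold lineWeight; decide
    simp [this, hy, h]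
  · rw [lineWeight_congr (p' := False) (q' := False) _ _ _ (by simp; omega) (by simp; omega)]
    have : lineWeight 1 1 0 False False = 2 := by
      unfold lineWeight; decide
    simp [this, hy, h.ne']

lemma lineWeight_const_add_le (y : Fin n → ZMod 3) (hk : 0 < k) :
    lineWeight u 0 0 (1 ≤ hammingNorm y ∧ hammingNorm y ≤ k) (hammingNorm y < k)
        + (if y = 0 then 1 else 0)
      ≤ 3 * (if hammingNorm y < k then 1 else 0) + (if hammingNorm y = k then 1 else 0) := by
  by_cases hy : y = 0
  · rw [lineWeight_congr (p' := False) (q' := True) _ _ _ (by simp [hy]) (by simp [hy, hk])]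
    have : ∀ u : ZMod 3, lineWeight u 0 0 False True ≤ 2 := by
      unfold lineWeight; decide
    have := this u
    simp [hy, hk]
    omega
  rcases lt_trichotomy (hammingNorm y) k with h | h | h
  · simpa [hy, h, h.ne] using lineWeight_le_three u 0 0 _ _
  · rw [lineWeight_congr (p' := (1 ≤ hammingNorm y)) (q' := False) _ _ _ (by simp; omega)
      (by simp; omega)]
    have : ∀ u : ZMod 3, ∀ b : Bool, lineWeight u 0 0 b False ≤ 1 := by
      unfold lineWeight; decide
    have := this u (decide (1 ≤ hammingNorm y))
    rw [lineWeight_congr (p' := (1 ≤ hammingNorm y)) (q' := False) _ _ _ (by simp) Iff.rfl] at this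
    simpa [hy, h] using this
  · rw [lineWeight_congr (p' := False) (q' := False) _ _ _ (by simp; omega) (by simp; omega)]
    have : ∀ u : ZMod 3, lineWeight u 0 0 False False = 0 := by
      unfold lineWeight; decide
    simp [this u, hy]

lemma hammingNorm_codeword_add_one_le (hk : 0 < k) (hkn : 2 * k ≤ n) :
    hammingNorm (codeword (n + 1) (gmk (n + 1) k) u v) + 1
      ≤ 2 * 3 ^ n + 2 ^ k * n.choose k := by
  have horigin : ∑ y : Fin n → ZMod 3, (if y = 0 then 1 else 0) = 1 := by simp
  by_cases hv : v = 0
  · have hball := two_mul_sum_hammingNorm_lt_le hkn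
    have hle := Finset.sum_le_sum fun (y : Fin n → ZMod 3) (_ : y ∈ univ) =>
      lineWeight_const_add_le (u := u) y hk
    rw [Finset.sum_add_distrib, Finset.sum_add_distrib, ← Finset.mul_sum, horigin,
      sum_hammingNorm_eq] at hle
    rw [hammingNorm_codeword 0]
    simp only [hv, Pi.zero_apply, zero_mul, Finset.sum_const_zero]
    omega
  obtain ⟨i, hi⟩ := Function.ne_iff.1 hv
  rw [hammingNorm_codeword i]
  by_cases hu : u = 0
  · have hline : ∀ a s : ZMod 3, a ≠ 0 → lineWeight 0 a s False False = 2 := by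
      unfold lineWeight; decide
    have hzero (a s : ZMod 3) (p q : Prop) [Decidable p] [Decidable q] :
        lineWeight 0 a s p q = lineWeight 0 a s False False := by
      simp [lineWeight]
    have : 0 < 2 ^ k * n.choose k :=
      Nat.mul_pos (by positivity) (Nat.choose_pos (by omega))
    simp only [hu, hzero, hline _ _ hi, Finset.sum_const, Finset.card_univ, Fintype.card_pi,
      ZMod.card, Finset.prod_const, Fintype.card_fin, smul_eq_mul]
    omega
  · have hle := Finset.sum_le_sum fun (y : Fin n → ZMod 3) (_ : y ∈ univ) =>
      lineWeight_add_le (y := y) (s := ∑ j, v (i.succAbove j) * y j) hk hu hi (by rintro rfl; simp)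
    rw [Finset.sum_add_distrib, Finset.sum_add_distrib, horigin, sum_hammingNorm_eq] at hle
    simpa [ZMod.card, mul_comm] using hle

lemma hammingNorm_codeword_single_add_one (hk : 0 < k) :
    hammingNorm (codeword (n + 1) (gmk (n + 1) k) 1 (Pi.single 0 1)) + 1
      = 2 * 3 ^ n + 2 ^ k * n.choose k := by
  have horigin : ∑ y : Fin n → ZMod 3, (if y = 0 then 1 else 0) = 1 := by simp
  have heq := Finset.sum_congr rfl fun (y : Fin n → ZMod 3) (_ : y ∈ univ) =>
    lineWeight_axis_add y hk
  rw [Finset.sum_add_distrib, Finset.sum_add_distrib, horigin, sum_hammingNorm_eq] at heq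
  rw [hammingNorm_codeword 0]
  simpa [ZMod.card, mul_comm] using heq

end Weights

/-- For `m ≥ 5` and `2 ≤ k ≤ ⌊(m-1)/2⌋`, the maximum Hamming weight of a
codeword of `C_{g_{(m,k)}}` equals `3^m - 3^(m-1) + 2^k·C(m-1,k) - 1`. -/
theorem stmt_15 (m k : ℕ) (hm : 5 ≤ m) (hk2 : 2 ≤ k) (hk : k ≤ (m - 1) / 2) :
    sSup {w : ℕ | ∃ c ∈ codeSet m (gmk m k), hammingNorm c = w}
      = 3 ^ m - 3 ^ (m - 1) + 2 ^ k * (m - 1).choose k - 1 := by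
  obtain ⟨n, rfl⟩ : ∃ n, m = n + 1 := ⟨m - 1, by omega⟩
  have hpow : 3 ^ (n + 1) - 3 ^ n = 2 * 3 ^ n := by rw [pow_succ]; omega
  rw [Nat.add_sub_cancel, hpow]
  refine IsGreatest.csSup_eq ⟨⟨_, ⟨1, Pi.single 0 1, rfl⟩, ?_⟩, ?_⟩
  · have := hammingNorm_codeword_single_add_one (n := n) (k := k) (by omega)
    omega
  · rintro _ ⟨_, ⟨u, v, rfl⟩, rfl⟩
    have := hammingNorm_codeword_add_one_le (n := n) (k := k) (u := u) (v := v)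
      (by omega) (by omega)
    omega
end

section
/- Let m and k be integers with m >= 5 and 2 <= k <= floor((m-1)/2). Then for every integer i with 1 <= i <= m, one has sum over j from 1 to k of 2^j * binomial(m,j) != -2*(Psi_k(i,m) - 1), where Psi_k is the Lloyd polynomial with q = 3. -/
/-- The Lloyd polynomial `Ψ_k(x,m)` with parameter `q`. -/
def lloyd (q k x m : ℕ) : ℤ :=
  ∑ t ∈ Finset.range (k + 1), krawtchouk q t x m

theorem two_pow_mul_choose_add_two_mul_krawtchouk (t i n : ℕ) :
    (2 : ℤ) ^ t * ((i + n).choose t) + 2 * krawtchouk 3 t i (i + n) =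
      ∑ j ∈ Finset.range (t + 1),
        (2 ^ j + 2 * (-1 : ℤ) ^ j) * 2 ^ (t - j) * (i.choose j) * (n.choose (t - j)) := by
  rw [Nat.add_choose_eq, Finset.Nat.sum_antidiagonal_eq_sum_range_succ_mk, krawtchouk]
  push_cast
  rw [Finset.mul_sum, Finset.mul_sum, ← Finset.sum_add_distrib]
  refine Finset.sum_congr rfl fun j hj => ?_
  have hjt : j + (t - j) = t := by
    have := Finset.mem_range.1 hj
    omega
  have hpow : (2 : ℤ) ^ t = 2 ^ j * 2 ^ (t - j) := by rw [← pow_add, hjt]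
  rw [hpow, Nat.add_sub_cancel_left]
  ring

theorem two_pow_add_two_mul_neg_one_pow_nonneg (j : ℕ) :
    0 ≤ (2 : ℤ) ^ j + 2 * (-1) ^ j := by
  cases j with
  | zero => norm_num
  | succ j =>
    have h : (1 : ℤ) ≤ 2 ^ j := one_le_pow₀ (by norm_num)
    rcases neg_one_pow_eq_or ℤ (j + 1) with h' | h' <;> rw [h', pow_succ] <;> linarith

theorem two_pow_mul_choose_add_two_mul_krawtchouk_nonneg (t i n : ℕ) :
    0 ≤ (2 : ℤ) ^ t * ((i + n).choose t) + 2 * krawtchouk 3 t i (i + n) := by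
  rw [two_pow_mul_choose_add_two_mul_krawtchouk]
  refine Finset.sum_nonneg fun j _ => ?_
  have := two_pow_add_two_mul_neg_one_pow_nonneg j
  positivity

theorem three_lt_sum_two_pow_mul_choose_add_two_mul_lloyd {k i n : ℕ} (hk : 2 ≤ k)
    (hi : 1 ≤ i) (hin : 2 ≤ i + n) :
    3 < (∑ t ∈ Finset.range (k + 1), (2 : ℤ) ^ t * ((i + n).choose t)) +
      2 * lloyd 3 k i (i + n) := by
  rw [lloyd, Finset.mul_sum, ← Finset.sum_add_distrib]
  refine lt_of_lt_of_le ?_ (Finset.sum_le_sum_of_subset_of_nonneg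
    (Finset.range_mono (show 3 ≤ k + 1 by omega))
    fun t _ _ => two_pow_mul_choose_add_two_mul_krawtchouk_nonneg t i n)
  simp only [two_pow_mul_choose_add_two_mul_krawtchouk]
  simp only [Finset.sum_range_succ, Finset.sum_range_zero]
  norm_num
  rcases Nat.lt_or_ge i 2 with h | h
  · have hn : (1 : ℤ) ≤ n := by exact_mod_cast (by omega : 1 ≤ n)
    have h1 : (0 : ℤ) ≤ (i.choose 2 : ℤ) := by positivity
    have h2 : (0 : ℤ) ≤ (n.choose 2 : ℤ) := by positivity
    linarith
  · have hn : (0 : ℤ) ≤ n := by positivity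
    have h1 : (1 : ℤ) ≤ (i.choose 2 : ℤ) := by exact_mod_cast Nat.choose_pos h
    have h2 : (0 : ℤ) ≤ (n.choose 2 : ℤ) := by positivity
    linarith

/-- For `m ≥ 5`, `2 ≤ k ≤ ⌊(m-1)/2⌋` and `1 ≤ i ≤ m`,
`∑_{j=1}^k 2^j·C(m,j) ≠ -2·(Ψ_k(i,m) - 1)` for the Lloyd polynomial with `q = 3`. -/
theorem stmt_16 (m k : ℕ) (hm : 5 ≤ m) (hk2 : 2 ≤ k) (hk : k ≤ (m - 1) / 2) :
    ∀ i : ℕ, 1 ≤ i → i ≤ m →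
      (∑ j ∈ Finset.Icc 1 k, (2 : ℤ) ^ j * (m.choose j)) ≠ -2 * (lloyd 3 k i m - 1) := by
  intro i hi him heq
  obtain ⟨n, rfl⟩ := Nat.exists_eq_add_of_le him
  have hlt := three_lt_sum_two_pow_mul_choose_add_two_mul_lloyd hk2 hi
    (show 2 ≤ i + n by omega)
  rw [Finset.range_eq_Ico, Finset.sum_eq_sum_Ico_succ_bot (Nat.succ_pos k)] at hlt
  have hIcc : Finset.Icc 1 k = Finset.Ico (0 + 1) (k + 1) := by
    ext
    simp only [Finset.mem_Icc, Finset.mem_Ico]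
    omega
  rw [hIcc] at heq
  simp only [pow_zero, Nat.choose_zero_right, Nat.cast_one] at hlt
  linarith
end
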